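/- Let G = (ρ, V, w) be a rooted directed weighted graph with N ≥ 1 non-root nodes, L its root-weighted Laplacian, and suppose det L ≠ 0; set B = (L^{-1})^T. Then for every non-root node j: ∑_{t∈D(G), (ρ,j)∈t} w(t) = (det L) · w_{ρj} · B_{1j}; and for all non-root nodes i ≠ j: ∑_{t∈D(G), (i,j)∈t} w(t) = (det L) · w_{ij} · ([j≠1]·B_{jj} − [i≠1]·B_{ij}), where [P] = 1 if P holds and 0 otherwise. Equivalently, under the distribution p(t) = w(t)/Z on dependency trees with Z = det L, the marginal probability of an edge is given by these formulas. -/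

import Mathlib

/-!
Nodes of a rooted directed weighted graph with `N` non-root nodes are encoded as
`Fin (N + 1)`, with the root `ρ` being `0` and the non-root nodes `1, …, N` being
`j.succ` for `j : Fin N`.  A candidate (spanning) tree is encoded by a parent
function `par : Fin N → Fin (N + 1)` assigning to each non-root node `j` the tail
of its unique incoming edge `(par j, j.succ)`.
-/

/-- One step upwards towards the root along the parent function (the root is a fixed point). -/
def Step {N : ℕ} (par : Fin N → Fin (N + 1)) : Fin (N + 1) → Fin (N + 1) :=
  fun v => if h : v = 0 then 0 else par (v.pred h)

/-- `par` encodes a directed spanning tree rooted at `0`: every node has exactly one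
incoming edge (built into the encoding) and there are no cycles, i.e. every node
reaches the root. -/
def IsSTree {N : ℕ} (par : Fin N → Fin (N + 1)) : Prop :=
  ∀ v : Fin (N + 1), (Step par)^[N] v = 0

instance {N : ℕ} (par : Fin N → Fin (N + 1)) : Decidable (IsSTree par) :=
  inferInstanceAs (Decidable (∀ v : Fin (N + 1), (Step par)^[N] v = 0))

/-- A dependency tree: a spanning tree with exactly one edge emanating from the root. -/
def IsDTree {N : ℕ} (par : Fin N → Fin (N + 1)) : Prop :=
  IsSTree par ∧ (Finset.univ.filter fun j : Fin N => par j = 0).card = 1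

instance {N : ℕ} (par : Fin N → Fin (N + 1)) : Decidable (IsDTree par) :=
  inferInstanceAs (Decidable (IsSTree par ∧
    (Finset.univ.filter fun j : Fin N => par j = 0).card = 1))

/-- The weight of a tree: the product of its edge weights. -/
def treeWeight {N : ℕ} (w : Fin (N + 1) → Fin (N + 1) → ℝ)
    (par : Fin N → Fin (N + 1)) : ℝ :=
  ∏ j : Fin N, w (par j) j.succ

/-- The root-weighted Laplacian of Koo et al.: rows/columns indexed by the non-root
nodes `1, …, N+1` (encoded as `Fin (N+1)`, with node "1" being index `0`). -/
def rootLap {N : ℕ} (w : Fin (N + 2) → Fin (N + 2) → ℝ) :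
    Matrix (Fin (N + 1)) (Fin (N + 1)) ℝ :=
  Matrix.of fun i j =>
    if i = 0 then w 0 j.succ
    else if i = j then ∑ i' ∈ Finset.univ.erase j, w i'.succ j.succ
    else -w i.succ j.succ

theorem step_zero {N : ℕ} (t : Fin N → Fin (N + 1)) : Step t 0 = 0 := by simp [Step]

theorem step_succ {N : ℕ} (t : Fin N → Fin (N + 1)) (j : Fin N) : Step t j.succ = t j := by
  simp [Step]

theorem step_iterate_zero {N : ℕ} (t : Fin N → Fin (N + 1)) (k : ℕ) : (Step t)^[k] 0 = 0 :=
  Function.iterate_fixed (step_zero t) k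

/-- The adjacency matrix of a parent function, restricted to the non-root nodes. -/
def parentMatrix {N : ℕ} (t : Fin N → Fin (N + 1)) : Matrix (Fin N) (Fin N) ℝ :=
  Matrix.of fun i j => if t i = j.succ then 1 else 0

theorem parentMatrix_mulVec {N : ℕ} (t : Fin N → Fin (N + 1)) (y : Fin (N + 1) → ℝ)
    (hy : y 0 = 0) (i : Fin N) :
    (parentMatrix t).mulVec (fun j => y j.succ) i = y (t i) := by
  simp only [Matrix.mulVec, dotProduct, parentMatrix, Matrix.of_apply, ite_mul, one_mul, zero_mul]
  cases h : t i using Fin.cases with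
  | zero => simp [hy, (Fin.succ_ne_zero _).symm]
  | succ k => simp

theorem parentMatrix_pow_apply {N : ℕ} (t : Fin N → Fin (N + 1)) (k : ℕ) (i j : Fin N) :
    (parentMatrix t ^ k) i j = if (Step t)^[k] i.succ = j.succ then 1 else 0 := by
  induction k generalizing i with
  | zero => simp [Matrix.one_apply]
  | succ k ih =>
    rw [pow_succ', Matrix.mul_apply, Function.iterate_succ_apply, step_succ]
    simp_rw [ih]
    exact parentMatrix_mulVec t (fun v => if (Step t)^[k] v = j.succ then 1 else 0)
      (by simp [step_iterate_zero, (Fin.succ_ne_zero _).symm]) i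

theorem parentMatrix_pow_eq_zero_iff {N : ℕ} (t : Fin N → Fin (N + 1)) (k : ℕ) :
    parentMatrix t ^ k = 0 ↔ ∀ v, (Step t)^[k] v = 0 := by
  constructor
  · intro h v
    cases v using Fin.cases with
    | zero => exact step_iterate_zero t k
    | succ i =>
      by_contra hne
      obtain ⟨j, hj⟩ := Fin.exists_succ_eq.mpr hne
      have := congrFun (congrFun h i) j
      simp [parentMatrix_pow_apply, hj] at this
  · intro h
    ext i j
    simp [parentMatrix_pow_apply, h, (Fin.succ_ne_zero _).symm]

theorem Matrix.charpoly_eq_X_pow_of_isNilpotent {n R : Type*} [Fintype n] [DecidableEq n]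
    [CommRing R] [IsDomain R] {A : Matrix n n R} (hA : IsNilpotent A) :
    A.charpoly = Polynomial.X ^ Fintype.card n :=
  sub_eq_zero.mp (Matrix.isNilpotent_charpoly_sub_pow_of_isNilpotent hA).eq_zero

theorem isSTree_iff_isNilpotent {N : ℕ} (t : Fin N → Fin (N + 1)) :
    IsSTree t ↔ IsNilpotent (parentMatrix t) := by
  constructor
  · intro h
    exact ⟨N, (parentMatrix_pow_eq_zero_iff t N).mpr h⟩
  · intro h
    have := Matrix.aeval_self_charpoly (parentMatrix t)
    rw [Matrix.charpoly_eq_X_pow_of_isNilpotent h] at this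
    exact (parentMatrix_pow_eq_zero_iff t N).mp (by simpa using this)

theorem det_one_sub_parentMatrix {N : ℕ} (t : Fin N → Fin (N + 1)) :
    (1 - parentMatrix t).det = if IsSTree t then 1 else 0 := by
  split_ifs with h
  · rw [isSTree_iff_isNilpotent] at h
    have := Matrix.eval_charpoly (parentMatrix t) 1
    rw [Matrix.charpoly_eq_X_pow_of_isNilpotent h] at this
    simpa using this.symm
  · obtain ⟨v, hv⟩ : ∃ v, ∀ k, (Step t)^[k] v ≠ 0 := by
      by_contra! hreach
      choose k hk using hreach
      refine h ((isSTree_iff_isNilpotent t).mpr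
        ⟨∑ v, k v, (parentMatrix_pow_eq_zero_iff t _).mpr fun v => ?_⟩)
      obtain ⟨m, hm⟩ := Nat.exists_eq_add_of_le'
        (Finset.single_le_sum (f := k) (fun _ _ => Nat.zero_le _) (Finset.mem_univ v))
      rw [hm, Function.iterate_add_apply, hk, step_iterate_zero]
    classical
    let y : Fin (N + 1) → ℝ := fun u => if ∀ k, (Step t)^[k] u ≠ 0 then 1 else 0
    have hy0 : y 0 = 0 := if_neg fun h0 => h0 0 rfl
    refine Matrix.exists_mulVec_eq_zero_iff.mp ⟨fun j => y j.succ, fun h0 => ?_, ?_⟩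
    · obtain ⟨j, rfl⟩ := Fin.exists_succ_eq.mpr (hv 0)
      simpa [y, hv] using congrFun h0 j
    · ext i
      rw [Matrix.sub_mulVec, Matrix.one_mulVec, Pi.sub_apply, parentMatrix_mulVec t y hy0,
        Pi.zero_apply, sub_eq_zero]
      refine if_congr ⟨fun hi k => ?_, fun hi k => ?_⟩ rfl rfl
      · simpa [step_succ] using hi (k + 1)
      · cases k with
        | zero => exact Fin.succ_ne_zero i
        | succ k => simpa [step_succ] using hi k

/-- The transposed root-weighted Laplacian of the graph consisting of the edges
of a parent function, each with weight one. -/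
def parentLap {N : ℕ} (t : Fin (N + 1) → Fin (N + 2)) :
    Matrix (Fin (N + 1)) (Fin (N + 1)) ℝ :=
  Matrix.of fun j i =>
    if i = 0 then (if t j = 0 then 1 else 0)
    else if t j = 0 then 0 else (1 - parentMatrix t) j i

theorem det_parentLap {N : ℕ} (t : Fin (N + 1) → Fin (N + 2)) :
    (parentLap t).det = if IsDTree t then 1 else 0 := by
  by_cases hcard : (Finset.univ.filter fun j : Fin (N + 1) => t j = 0).card = 1
  · have hD : IsDTree t ↔ IsSTree t := and_iff_left hcard
    simp only [hD, ← det_one_sub_parentMatrix]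
    obtain ⟨r, hr⟩ := Finset.card_eq_one.mp hcard
    have hr : ∀ j, t j = 0 ↔ j = r := fun j => by simpa using Finset.ext_iff.mp hr j
    let K := 1 - parentMatrix t
    have hrow : ∀ j, ∑ i, K j i = if t j = 0 then 1 else 0 := by
      intro j
      have : ∑ i, K j i = 1 - ∑ i, parentMatrix t j i := by
        simp [K, Matrix.one_apply, Finset.sum_sub_distrib]
      rw [this]
      have := parentMatrix_mulVec t (fun v => if v = 0 then 0 else 1) (by simp) j
      simp [Matrix.mulVec, dotProduct] at this
      rw [this]
      split_ifs <;> simp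
    have hupd : (K.updateCol 0 fun j => if t j = 0 then 1 else 0).det = K.det := by
      have := Matrix.det_updateCol_sum K 0 (fun _ => 1)
      simpa [hrow] using this
    rw [← hupd, ← Matrix.det_transpose, ← Matrix.det_transpose (K.updateCol _ _)]
    refine Matrix.det_eq_of_forall_row_eq_smul_add_const
      (fun i => if i = 0 then 0 else if i = r then -1 else 0) 0 (by simp) fun i j => ?_
    by_cases hi : i = 0
    · simp [parentLap, hi]
    · by_cases hj : j = r
      · have htj := (hr j).mpr hj
        subst hj
        by_cases hij : i = j
        · subst hij
          simp [parentLap, hi, htj, K, parentMatrix, (Fin.succ_ne_zero _).symm]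
        · simp [parentLap, hi, htj, K, hij, parentMatrix, (Fin.succ_ne_zero _).symm,
            Matrix.one_apply, Ne.symm hij]
      · have htj := mt (hr j).mp hj
        simp [parentLap, hi, htj, K]
  · rw [if_neg fun h => hcard h.2]
    by_cases h0 : ∃ j, t j = 0
    · obtain ⟨j, hj⟩ := h0
      have hlt : 1 < (Finset.univ.filter fun j : Fin (N + 1) => t j = 0).card := by
        have : 0 < (Finset.univ.filter fun j : Fin (N + 1) => t j = 0).card :=
          Finset.card_pos.mpr ⟨j, by simpa using hj⟩
        omega
      obtain ⟨a, ha, b, hb, hab⟩ := Finset.one_lt_card.mp hlt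
      simp only [Finset.mem_filter, Finset.mem_univ, true_and] at ha hb
      exact Matrix.det_zero_of_row_eq hab (by ext i; simp [parentLap, ha, hb])
    · push Not at h0
      exact Matrix.det_eq_zero_of_column_eq_zero 0 fun j => by simp [parentLap, h0]

/-- The column of the root-weighted Laplacian contributed by the unit-weight edge
from `k` to `j.succ`. -/
def lapCol {N : ℕ} (k : Fin (N + 2)) (j : Fin (N + 1)) : Fin (N + 1) → ℝ := fun i =>
  if i = 0 then (if k = 0 then 1 else 0)
  else if k = 0 then 0 else (if i = j then 1 else 0) - (if k = i.succ then 1 else 0)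

theorem rootLap_transpose {N : ℕ} (w : Fin (N + 2) → Fin (N + 2) → ℝ) (j : Fin (N + 1)) :
    (rootLap w).transpose j = ∑ k, w k j.succ • lapCol k j := by
  ext i
  rw [Fin.sum_univ_succ]
  simp only [rootLap, lapCol, Matrix.transpose_apply, Matrix.of_apply, Pi.add_apply,
    Finset.sum_apply, Pi.smul_apply, smul_eq_mul, if_true, Fin.succ_ne_zero, if_false,
    Fin.succ_inj]
  by_cases hi : i = 0
  · simp [hi]
  · by_cases hij : i = j
    · subst hij
      simp [hi, mul_sub, Finset.sum_sub_distrib, Finset.sum_erase_eq_sub]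
    · simp [hi, hij]

/-- Matrix-tree theorem for dependency trees. -/
theorem sum_isDTree_treeWeight {N : ℕ} (w : Fin (N + 2) → Fin (N + 2) → ℝ) :
    (∑ t : Fin (N + 1) → Fin (N + 2), if IsDTree t then treeWeight w t else 0)
      = (rootLap w).det := by
  have hdet : (rootLap w).det = Matrix.detRowAlternating.toMultilinearMap
      fun j => ∑ k, w k j.succ • lapCol k j := by
    rw [← Matrix.det_transpose]
    exact congrArg Matrix.detRowAlternating (funext (rootLap_transpose w))
  rw [hdet, MultilinearMap.map_sum]
  refine Finset.sum_congr rfl fun t _ => ?_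
  rw [MultilinearMap.map_smul_univ]
  have hlap : Matrix.detRowAlternating.toMultilinearMap (fun j => lapCol (t j) j)
      = (parentLap t).det := by
    refine congrArg Matrix.detRowAlternating (funext fun j => funext fun i => ?_)
    simp [lapCol, parentLap, parentMatrix, Matrix.one_apply, eq_comm]
  rw [hlap, det_parentLap, treeWeight]
  split_ifs <;> simp

/-- The weight of the dependency trees containing the edge from `k` to `j.succ`. -/
theorem sum_isDTree_edge {N : ℕ} (w : Fin (N + 2) → Fin (N + 2) → ℝ)
    (k : Fin (N + 2)) (j : Fin (N + 1)) :
    (∑ t : Fin (N + 1) → Fin (N + 2), if IsDTree t ∧ t j = k then treeWeight w t else 0)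
      = w k j.succ * (rootLap w).cramer (lapCol k j) j := by
  let w' : Fin (N + 2) → Fin (N + 2) → ℝ := fun a b =>
    if b = j.succ ∧ a ≠ k then 0 else w a b
  have hw' : rootLap w' = (rootLap w).updateCol j (w k j.succ • lapCol k j) := by
    rw [← Matrix.transpose_inj, ← Matrix.updateRow_transpose]
    ext l : 1
    by_cases hl : l = j
    · subst hl
      rw [rootLap_transpose, Matrix.updateRow_self, Finset.sum_eq_single k]
      · simp [w']
      · intro b _ hb
        simp [w', hb]
      · simp
    · rw [Matrix.updateRow_ne hl, rootLap_transpose, rootLap_transpose]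
      simp [w', hl]
  rw [← smul_eq_mul, ← Pi.smul_apply, ← map_smul, Matrix.cramer_apply, ← hw',
    ← sum_isDTree_treeWeight]
  refine Finset.sum_congr rfl fun t _ => ?_
  by_cases ht : t j = k
  · have : treeWeight w' t = treeWeight w t := by
      refine Finset.prod_congr rfl fun l _ => if_neg ?_
      rintro ⟨hl, hne⟩
      exact hne (Fin.succ_inj.mp hl ▸ ht)
    simp [ht, this]
  · have : treeWeight w' t = 0 := Finset.prod_eq_zero (Finset.mem_univ j) (by simp [w', ht])
    simp [ht, this]

/-- edge marginals for dependency trees, Koo et al..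
With `B = (L⁻¹)ᵀ` for the root-weighted Laplacian `L` (assumed nonsingular):
for a root edge `(ρ, j)`, `∑_{t ∈ D(G), (ρ,j) ∈ t} w(t) = det L · w_{ρj} · B_{1j}`,
and for an edge `(i, j)` between distinct non-root nodes,
`∑_{t ∈ D(G), (i,j) ∈ t} w(t) = det L · w_{ij} · ([j ≠ 1] B_{jj} − [i ≠ 1] B_{ij})`
(node "1" of the paper is index `0` here). -/
theorem dtree_edge_marginals {N : ℕ}
    (w : Fin (N + 2) → Fin (N + 2) → ℝ) (hw : ∀ i j, 0 ≤ w i j)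
    (hdet : (rootLap w).det ≠ 0)
    (B : Matrix (Fin (N + 1)) (Fin (N + 1)) ℝ)
    (hB : B = (rootLap w)⁻¹.transpose) :
    (∀ j : Fin (N + 1),
      (∑ t : Fin (N + 1) → Fin (N + 2),
          if IsDTree t ∧ t j = 0 then treeWeight w t else 0)
        = (rootLap w).det * (w 0 j.succ * B 0 j))
    ∧ ∀ i j : Fin (N + 1), i ≠ j →
      (∑ t : Fin (N + 1) → Fin (N + 2),
          if IsDTree t ∧ t j = i.succ then treeWeight w t else 0)
        = (rootLap w).det * (w i.succ j.succ *
            ((if j = 0 then 0 else B j j) - (if i = 0 then 0 else B i j))) := by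
  have hsum := fun k j => (sum_isDTree_edge w k j).trans (by
    rw [← Matrix.det_smul_inv_mulVec_eq_cramer _ _ (isUnit_iff_ne_zero.mpr hdet)])
  subst hB
  refine ⟨fun j => ?_, fun i j hij => ?_⟩
  · rw [hsum]
    have : lapCol 0 j = Pi.single 0 1 := by
      ext i
      simp [lapCol, Pi.single_apply]
    rw [this]
    simp
    ring
  · rw [hsum]
    have : lapCol i.succ j = (if j = 0 then 0 else Pi.single j 1)
        - (if i = 0 then 0 else Pi.single i 1) := by
      ext l
      simp only [lapCol, Fin.succ_ne_zero, Fin.succ_inj, if_false, Pi.sub_apply, ite_apply,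
        Pi.zero_apply, Pi.single_apply]
      grind
    rw [this, Matrix.mulVec_sub]
    by_cases hi : i = 0 <;> by_cases hj : j = 0 <;> simp [hi, hj] <;> ring
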